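/- In the BIBPA setting, assume the parameter conditions: for all k ≥ 1 and i, |α_i^k| < σ_i/2, 0 < γ_i ≤ γ_i^k ≤ (σ_i − 2|α_i^k|)/(σ_i L_i), and δ_i ≥ 0 with |α_i^k|/(σ_i γ_i^k) ≤ δ_i ≤ (1 − γ_i^k L_i)/γ_i^k − |α_i^k|/(σ_i γ_i^k). If Φ has bounded sublevel sets (for every c ∈ ℝ the set {x ∈ E : Φ(x) ≤ c} is bounded), then the sequence (x^k)_{k≥0} generated by BIBPA is bounded. -/

import Mathlib

open scoped RealInnerProductSpace
open Filter

/-- The `i`-th partial (block) gradient of `h` at `x`. -/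
noncomputable def blockGrad {N : ℕ} {n : Fin N → ℕ}
    (h : ((j : Fin N) → EuclideanSpace ℝ (Fin (n j))) → ℝ)
    (i : Fin N) (x : (j : Fin N) → EuclideanSpace ℝ (Fin (n j))) :
    EuclideanSpace ℝ (Fin (n i)) :=
  gradient (fun z => h (Function.update x i z)) (x i)

/-- The `i`-th block Bregman distance `D_h(x⟨i←w⟩, x)`. -/
noncomputable def blockBreg {N : ℕ} {n : Fin N → ℕ}
    (h : ((j : Fin N) → EuclideanSpace ℝ (Fin (n j))) → ℝ)
    (i : Fin N) (x : (j : Fin N) → EuclideanSpace ℝ (Fin (n j)))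
    (w : EuclideanSpace ℝ (Fin (n i))) : ℝ :=
  h (Function.update x i w) - h x - ⟪blockGrad h i x, w - x i⟫

/-- The `i`-th block Bregman distance `D_h(y, y')` between two points differing
only in their `i`-th block. -/
noncomputable def bregTwo {N : ℕ} {n : Fin N → ℕ}
    (h : ((j : Fin N) → EuclideanSpace ℝ (Fin (n j))) → ℝ)
    (i : Fin N) (y y' : (j : Fin N) → EuclideanSpace ℝ (Fin (n j))) : ℝ :=
  h y - h y' - ⟪blockGrad h i y', y i - y' i⟫

/-- The intermediate BIBPA point `x^{k,m}` whose first `m` blocks come from `x^{k+1}`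
and whose remaining blocks come from `x^k`. -/
def interPt {N : ℕ} {n : Fin N → ℕ}
    (x : ℕ → (j : Fin N) → EuclideanSpace ℝ (Fin (n j))) (k m : ℕ) :
    (j : Fin N) → EuclideanSpace ℝ (Fin (n j)) :=
  fun j => if (j : ℕ) < m then x (k + 1) j else x k j

/-- The BIBPA objective `Φ(x) = f(x) + Σᵢ gᵢ(xᵢ)` with extended-real valued `gᵢ`. -/
noncomputable def Phi {N : ℕ} {n : Fin N → ℕ}
    (f : ((j : Fin N) → EuclideanSpace ℝ (Fin (n j))) → ℝ)
    (g : (i : Fin N) → EuclideanSpace ℝ (Fin (n i)) → EReal)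
    (y : (j : Fin N) → EuclideanSpace ℝ (Fin (n j))) : EReal :=
  ((f y : ℝ) : EReal) + ∑ i, g i (y i)

/-- First-order characterization of convexity: a convex function lies above its tangent planes. -/
theorem ConvexOn.add_fderiv_sub_le {E : Type*} [NormedAddCommGroup E] [NormedSpace ℝ E]
    {φ : E → ℝ} (hφ : ConvexOn ℝ Set.univ φ) {φ' : E →L[ℝ] ℝ} {v : E}
    (hd : HasFDerivAt φ φ' v) (w : E) : φ v + φ' (w - v) ≤ φ w := by
  have hline : HasDerivAt (fun t : ℝ => AffineMap.lineMap v w t) (w - v) 0 :=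
    AffineMap.hasDerivAt_lineMap
  have hd' : HasFDerivAt φ φ' (AffineMap.lineMap v w (0 : ℝ)) := by simpa using hd
  have hconv : ConvexOn ℝ Set.univ (φ ∘ AffineMap.lineMap (k := ℝ) v w) :=
    hφ.comp_affineMap (AffineMap.lineMap v w)
  have hslope := hconv.le_slope_of_hasDerivAt (Set.mem_univ 0) (Set.mem_univ 1) one_pos
    (hd'.comp_hasDerivAt 0 hline)
  simp only [slope_def_field, Function.comp_apply, AffineMap.lineMap_apply_zero,
    AffineMap.lineMap_apply_one, sub_zero, div_one] at hslope
  linarith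

section Block

variable {N : ℕ} {n : Fin N → ℕ}

theorem hasFDerivAt_blockGrad {h : ((j : Fin N) → EuclideanSpace ℝ (Fin (n j))) → ℝ}
    (hh : Differentiable ℝ h) (i : Fin N) (x : (j : Fin N) → EuclideanSpace ℝ (Fin (n j))) :
    HasFDerivAt (fun z => h (Function.update x i z))
      (InnerProductSpace.toDual ℝ _ (blockGrad h i x)) (x i) := by
  have hd : Differentiable ℝ (fun z => h (Function.update x i z)) :=
    hh.comp fun z => (hasFDerivAt_update x z).differentiableAt
  exact (hd (x i)).hasGradientAt.hasFDerivAt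

/-- Strong convexity along a block bounds the block Bregman distance from below. -/
theorem half_mul_norm_sub_sq_le_blockBreg
    {h : ((j : Fin N) → EuclideanSpace ℝ (Fin (n j))) → ℝ} (hh : Differentiable ℝ h)
    {i : Fin N} {x : (j : Fin N) → EuclideanSpace ℝ (Fin (n j))} {s : ℝ}
    (hconv : ConvexOn ℝ Set.univ (fun z : EuclideanSpace ℝ (Fin (n i)) =>
      h (Function.update x i z) - s / 2 * ‖z‖ ^ 2)) (w : EuclideanSpace ℝ (Fin (n i))) :
    s / 2 * ‖w - x i‖ ^ 2 ≤ blockBreg h i x w := by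
  have key := hconv.add_fderiv_sub_le ((hasFDerivAt_blockGrad hh i x).sub
    ((hasStrictFDerivAt_norm_sq (x i)).hasFDerivAt.const_mul (s / 2))) w
  have hexp : ‖w‖ ^ 2 = ‖x i‖ ^ 2 + 2 * ⟪x i, w - x i⟫ + ‖w - x i‖ ^ 2 := by
    rw [← norm_add_sq_real, add_sub_cancel]
  simp only [Function.update_eq_self, sub_apply,
    smul_apply, InnerProductSpace.toDual_apply_apply, innerSL_apply_apply,
    smul_eq_mul, nsmul_eq_mul, Nat.cast_ofNat] at key
  rw [blockBreg]
  linear_combination key - s / 2 * hexp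

/-- The descent lemma along a block under relative smoothness. -/
theorem update_le_add_inner_add_blockBreg
    {f h : ((j : Fin N) → EuclideanSpace ℝ (Fin (n j))) → ℝ} (hf : Differentiable ℝ f)
    (hh : Differentiable ℝ h) {i : Fin N} {x : (j : Fin N) → EuclideanSpace ℝ (Fin (n j))} {c : ℝ}
    (hconv : ConvexOn ℝ Set.univ (fun z : EuclideanSpace ℝ (Fin (n i)) =>
      c * h (Function.update x i z) - f (Function.update x i z)))
    (w : EuclideanSpace ℝ (Fin (n i))) :
    f (Function.update x i w) ≤ f x + ⟪blockGrad f i x, w - x i⟫ + c * blockBreg h i x w := by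
  have key := hconv.add_fderiv_sub_le
    (((hasFDerivAt_blockGrad hh i x).const_mul c).sub (hasFDerivAt_blockGrad hf i x)) w
  simp only [Function.update_eq_self, sub_apply,
    smul_apply, InnerProductSpace.toDual_apply_apply, smul_eq_mul] at key
  rw [blockBreg]
  linear_combination key

theorem blockBreg_self (h : ((j : Fin N) → EuclideanSpace ℝ (Fin (n j))) → ℝ) (i : Fin N)
    (x : (j : Fin N) → EuclideanSpace ℝ (Fin (n j))) : blockBreg h i x (x i) = 0 := by
  simp [blockBreg]

theorem interPt_apply_self (x : ℕ → (j : Fin N) → EuclideanSpace ℝ (Fin (n j))) (k : ℕ)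
    (i : Fin N) : interPt x k i i = x k i := by
  simp [interPt]

theorem interPt_zero (x : ℕ → (j : Fin N) → EuclideanSpace ℝ (Fin (n j))) (k : ℕ) :
    interPt x k 0 = x k := by
  ext1 j
  simp [interPt]

theorem interPt_last (x : ℕ → (j : Fin N) → EuclideanSpace ℝ (Fin (n j))) (k : ℕ) :
    interPt x k N = x (k + 1) := by
  ext1 j
  simp [interPt]

theorem interPt_succ (x : ℕ → (j : Fin N) → EuclideanSpace ℝ (Fin (n j))) (k : ℕ) (i : Fin N) :
    interPt x k (i + 1) = Function.update (interPt x k i) i (x (k + 1) i) := by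
  ext1 j
  rcases eq_or_ne j i with rfl | hji
  · simp [interPt]
  · have hlt : (j : ℕ) < i + 1 ↔ (j : ℕ) < i := by
      have := Fin.val_ne_of_ne hji
      omega
    simp [interPt, hji, hlt]

theorem Phi_eq_coe {f : ((j : Fin N) → EuclideanSpace ℝ (Fin (n j))) → ℝ}
    {g : (i : Fin N) → EuclideanSpace ℝ (Fin (n i)) → EReal}
    {y : (j : Fin N) → EuclideanSpace ℝ (Fin (n j))}
    (htop : ∀ i, g i (y i) ≠ ⊤) (hbot : ∀ i, g i (y i) ≠ ⊥) :
    Phi f g y = ((f y + ∑ i, (g i (y i)).toReal : ℝ) : EReal) := by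
  have hsum : ((∑ i, (g i (y i)).toReal : ℝ) : EReal) = ∑ i, ((g i (y i)).toReal : EReal) :=
    map_sum (⟨⟨Real.toEReal, EReal.coe_zero⟩, EReal.coe_add⟩ : ℝ →+ EReal) _ _
  rw [Phi, EReal.coe_add, hsum]
  congr 1
  exact Finset.sum_congr rfl fun i _ => (EReal.coe_toReal (htop i) (hbot i)).symm

end Block

/-- The inertial term is absorbed by the weighted squared steps. -/
theorem inertial_descent_estimate {E : Type*} [NormedAddCommGroup E] [InnerProductSpace ℝ E]
    {a γ c s d D : ℝ} (hγ : 0 < γ) (hs : 0 < s) (hd : 0 ≤ d)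
    (hlow : |a| / (s * γ) ≤ d) (hupp : d ≤ (1 - γ * c) / γ - |a| / (s * γ)) (u v : E)
    (hD : s / 2 * ‖v‖ ^ 2 ≤ D) :
    a / γ * ⟪u, v⟫ - (1 / γ - c) * D ≤ s * d / 2 * ‖u‖ ^ 2 - s * d / 2 * ‖v‖ ^ 2 := by
  set r := |a| / (s * γ) with hr
  have hr0 : 0 ≤ r := by positivity
  have hrs : |a| / γ = s * r := by rw [hr]; field_simp
  have hcoef : (1 - γ * c) / γ = 1 / γ - c := by field_simp
  have hinner : a / γ * ⟪u, v⟫ ≤ s * r * (‖u‖ * ‖v‖) := by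
    rw [← hrs]
    calc a / γ * ⟪u, v⟫ ≤ |a / γ * ⟪u, v⟫| := le_abs_self _
      _ = |a| / γ * |⟪u, v⟫| := by rw [abs_mul, abs_div, abs_of_pos hγ]
      _ ≤ |a| / γ * (‖u‖ * ‖v‖) := by gcongr; exact abs_real_inner_le_norm u v
  have hyoung : s * r * (‖u‖ * ‖v‖) ≤ s * r / 2 * ‖u‖ ^ 2 + s * r / 2 * ‖v‖ ^ 2 := by
    have := mul_nonneg (mul_nonneg hs.le hr0) (sq_nonneg (‖u‖ - ‖v‖))
    linarith
  have hu : s * r / 2 * ‖u‖ ^ 2 ≤ s * d / 2 * ‖u‖ ^ 2 := by gcongr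
  have hdec : (d + r) * (s / 2 * ‖v‖ ^ 2) ≤ (1 / γ - c) * D :=
    mul_le_mul (by linarith) hD (by positivity) (by linarith)
  linarith

/-- Boundedness of the BIBPA iterates when Φ has bounded sublevel sets. -/
theorem bibpa_iterates_bounded
    {N : ℕ} {n : Fin N → ℕ}
    (h : (i : Fin N) → ((j : Fin N) → EuclideanSpace ℝ (Fin (n j))) → ℝ)
    (σ L : Fin N → ℝ) (hσ : ∀ i, 0 < σ i) (hL : ∀ i, 0 < L i)
    (hhdiff : ∀ i, Differentiable ℝ (h i))
    (hstrong : ∀ i x, ConvexOn ℝ Set.univ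
      (fun z : EuclideanSpace ℝ (Fin (n i)) =>
        h i (Function.update x i z) - σ i / 2 * ‖z‖ ^ 2))
    (f : ((j : Fin N) → EuclideanSpace ℝ (Fin (n j))) → ℝ)
    (hfdiff : Differentiable ℝ f)
    (hrel : ∀ i x, ConvexOn ℝ Set.univ
      (fun z : EuclideanSpace ℝ (Fin (n i)) =>
        L i * h i (Function.update x i z) - f (Function.update x i z)))
    (g : (i : Fin N) → EuclideanSpace ℝ (Fin (n i)) → EReal)
    (hgproper : ∀ i, ∃ z, g i z ≠ ⊤) (hgreal : ∀ i z, g i z ≠ ⊥)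
    (hglsc : ∀ i, LowerSemicontinuous (g i))
    (x : ℕ → (j : Fin N) → EuclideanSpace ℝ (Fin (n j)))
    (γ α : Fin N → ℕ → ℝ) (hγpos : ∀ i k, 0 < γ i k)
    (hfin : ∀ k i, g i (x k i) ≠ ⊤)
    (hmin : ∀ k, 1 ≤ k → ∀ (i : Fin N) (z : EuclideanSpace ℝ (Fin (n i))),
      g i (x (k + 1) i)
        + ((⟪blockGrad f i (interPt x k i)
              - (α i k / γ i k) • (x k i - x (k - 1) i), x (k + 1) i - x k i⟫
            + 1 / γ i k * blockBreg (h i) i (interPt x k i) (x (k + 1) i) : ℝ) : EReal)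
      ≤ g i z
        + ((⟪blockGrad f i (interPt x k i)
              - (α i k / γ i k) • (x k i - x (k - 1) i), z - x k i⟫
            + 1 / γ i k * blockBreg (h i) i (interPt x k i) z : ℝ) : EReal))
    (γlb : Fin N → ℝ) (hγlb : ∀ i, 0 < γlb i)
    (hα : ∀ k, 1 ≤ k → ∀ i, |α i k| < σ i / 2)
    (hγbounds : ∀ k, 1 ≤ k → ∀ i,
      γlb i ≤ γ i k ∧ γ i k ≤ (σ i - 2 * |α i k|) / (σ i * L i))
    (δ : Fin N → ℝ) (hδ0 : ∀ i, 0 ≤ δ i)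
    (hδ : ∀ k, 1 ≤ k → ∀ i,
      |α i k| / (σ i * γ i k) ≤ δ i
        ∧ δ i ≤ (1 - γ i k * L i) / γ i k - |α i k| / (σ i * γ i k))
    (hsublevel : ∀ c : ℝ, Bornology.IsBounded
      {y : (j : Fin N) → EuclideanSpace ℝ (Fin (n j)) | Phi f g y ≤ (c : EReal)}) :
    Bornology.IsBounded (Set.range x) := by
  have hbot : ∀ k i, g i (x k i) ≠ ⊥ := fun k i => hgreal i _
  set step : ℕ → Fin N → ℝ := fun k i => σ i * δ i / 2 * ‖x k i - x (k - 1) i‖ ^ 2 with hstep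
  have hblock : ∀ k, 1 ≤ k → ∀ i : Fin N,
      f (interPt x k (i + 1)) - f (interPt x k i) ≤
        (g i (x k i)).toReal - (g i (x (k + 1) i)).toReal + step k i - step (k + 1) i := by
    intro k hk i
    have hopt := hmin k hk i (x k i)
    have hself : blockBreg (h i) i (interPt x k i) (x k i) = 0 := by
      conv_lhs => rw [← interPt_apply_self x k i]
      exact blockBreg_self _ _ _
    rw [hself, sub_self, inner_zero_right, mul_zero, add_zero, EReal.coe_zero, add_zero,
      ← EReal.coe_toReal (hfin k i) (hbot k i),
      ← EReal.coe_toReal (hfin (k + 1) i) (hbot (k + 1) i), ← EReal.coe_add,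
      EReal.coe_le_coe_iff, inner_sub_left, real_inner_smul_left] at hopt
    have hdesc := update_le_add_inner_add_blockBreg hfdiff (hhdiff i)
      (hrel i (interPt x k i)) (x (k + 1) i)
    have hlow := half_mul_norm_sub_sq_le_blockBreg (hhdiff i)
      (hstrong i (interPt x k i)) (x (k + 1) i)
    rw [interPt_apply_self] at hdesc hlow
    have hest := inertial_descent_estimate (hγpos i k) (hσ i) (hδ0 i) (hδ k hk i).1
      (by simpa only [mul_comm] using (hδ k hk i).2) (x k i - x (k - 1) i) _ hlow
    rw [interPt_succ]
    simp only [hstep, add_tsub_cancel_right]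
    linarith
  set V : ℕ → ℝ := fun k => f (x k) + ∑ i, (g i (x k i)).toReal + ∑ i, step k i with hV
  have hdecr : ∀ k, 1 ≤ k → V (k + 1) ≤ V k := by
    intro k hk
    have hsum := Finset.sum_le_sum fun i (_ : i ∈ Finset.univ) => hblock k hk i
    rw [Fin.sum_univ_eq_sum_range (fun m => f (interPt x k (m + 1)) - f (interPt x k m)),
      Finset.sum_range_sub (fun m => f (interPt x k m)), interPt_zero, interPt_last,
      Finset.sum_sub_distrib, Finset.sum_add_distrib, Finset.sum_sub_distrib] at hsum
    simp only [hV]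
    linarith
  have hbound : ∀ k, 1 ≤ k → V k ≤ V 1 := fun k hk =>
    Nat.le_induction le_rfl (fun m hm ih => (hdecr m hm).trans ih) k hk
  refine ((hsublevel (V 1)).insert (x 0)).subset ?_
  rintro _ ⟨k, rfl⟩
  rcases Nat.eq_zero_or_pos k with rfl | hk
  · exact Set.mem_insert _ _
  · refine Set.mem_insert_of_mem _ ?_
    rw [Set.mem_ofPred_eq, Phi_eq_coe (hfin k) (hbot k), EReal.coe_le_coe_iff]
    have hstep_nonneg : 0 ≤ ∑ i, step k i := Finset.sum_nonneg fun i _ =>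
      mul_nonneg (div_nonneg (mul_nonneg (hσ i).le (hδ0 i)) zero_le_two) (sq_nonneg _)
    have := hbound k hk
    simp only [hV] at this ⊢
    linarith
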